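/- arXiv:1804.03510 — 6 statements merged into one kernel-verified Lean document; each statement's English description precedes it below -/
import Mathlib

section
/- Let ρ and σ be nonzero positive semidefinite operators on a finite-dimensional complex inner product space H. Then the following are equivalent: (a) ρ is absolutely continuous with respect to σ (ρ ≪ σ); (b) there exists a positive definite operator R on H with R ρ R ≤ σ; (c) there exists a positive definite operator R on H with ρ ≤ R σ R. -/
open Matrix
open scoped Matrix ComplexOrder

/-- `ρ` is absolutely continuous with respect to `σ`: the compression of `σ` to the
support (= range, for positive semidefinite `ρ`) of `ρ` is positive definite. -/
def AbsContWrt {ι : Type*} [Fintype ι] [DecidableEq ι] (ρ σ : Matrix ι ι ℂ) : Prop :=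
  ∀ x : ι → ℂ, (∃ y, ρ.mulVec y = x) → x ≠ 0 → 0 < (star x ⬝ᵥ σ.mulVec x).re

/-- The compact spectral decomposition of a positive semidefinite matrix. -/
theorem Matrix.PosSemidef.exists_isometry_mul_diagonal {ι : Type*} [Fintype ι] [DecidableEq ι]
    {ρ : Matrix ι ι ℂ} (hρ : ρ.PosSemidef) :
    ∃ (p : ι → Prop) (_ : DecidablePred p) (V : Matrix ι {i // p i} ℂ) (d : {i // p i} → ℝ),
      (∀ i, 0 < d i) ∧ Vᴴ * V = 1 ∧ ρ = V * diagonal (fun i => (d i : ℂ)) * Vᴴ := by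
  classical
  set U : Matrix ι ι ℂ := hρ.1.eigenvectorUnitary.1 with hU
  have hUU : Uᴴ * U = 1 := Unitary.coe_star_mul_self hρ.1.eigenvectorUnitary
  refine ⟨fun i => hρ.1.eigenvalues i ≠ 0, inferInstance, U.submatrix id Subtype.val,
    fun i => hρ.1.eigenvalues i, fun i => (hρ.eigenvalues_nonneg i).lt_of_ne' i.2, ?_, ?_⟩
  · rw [conjTranspose_submatrix, ← submatrix_mul _ _ _ _ _ Function.bijective_id, hUU]
    exact submatrix_one _ Subtype.val_injective
  · conv_lhs => rw [hρ.1.spectral_theorem]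
    ext i j
    rw [Unitary.conjStarAlgAut_apply, mul_apply, mul_apply]
    simp only [← hU, star_eq_conjTranspose, mul_diagonal, conjTranspose_apply, submatrix_apply,
      id, Function.comp_apply]
    rw [← Finset.sum_subtype (Finset.univ.filter fun k => hρ.1.eigenvalues k ≠ 0)
      (p := fun k => hρ.1.eigenvalues k ≠ 0) (by simp)
      fun k => U i k * (hρ.1.eigenvalues k : ℂ) * star (U j k)]
    refine (Finset.sum_filter_of_ne fun k _ hk => ?_).symm
    contrapose! hk
    simp [hk]

/-- The inverse of a positive definite matrix has a positive definite square root. -/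
theorem Matrix.PosDef.exists_posDef_mul_self_mul_eq_one {κ : Type*} [Fintype κ] [DecidableEq κ]
    {A : Matrix κ κ ℂ} (hA : A.PosDef) :
    ∃ B : Matrix κ κ ℂ, B.PosDef ∧ B * B * A = 1 := by
  open scoped MatrixOrder in
  have hB : CFC.sqrt A⁻¹ * CFC.sqrt A⁻¹ = A⁻¹ := CFC.sqrt_mul_sqrt_self _ hA.inv.posSemidef.nonneg
  open scoped MatrixOrder in
  refine ⟨CFC.sqrt A⁻¹, ?_, ?_⟩
  · refine (CFC.sqrt_nonneg A⁻¹).posSemidef.posDef_iff_isUnit.2 ?_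
    exact isUnit_of_mul_isUnit_left (hB ▸ hA.inv.isUnit)
  · rw [hB, nonsing_inv_mul _ ((isUnit_iff_isUnit_det A).1 hA.isUnit)]

/-- If the compression of `σ` to the range of the isometry `V` is positive definite, then
`R * (V * Vᴴ) * R ≤ σ` for some positive definite `R`. -/
theorem Matrix.PosSemidef.exists_posDef_sandwich_le {ι κ : Type*} [Fintype ι] [DecidableEq ι]
    [Fintype κ] [DecidableEq κ] {σ : Matrix ι ι ℂ} (hσ : σ.PosSemidef) {V : Matrix ι κ ℂ}
    (hV : Vᴴ * V = 1) (hA : (Vᴴ * σ * V).PosDef) :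
    ∃ R : Matrix ι ι ℂ, R.PosDef ∧ (σ - R * (V * Vᴴ) * R).PosSemidef := by
  obtain ⟨B, hB, hBA⟩ := hA.exists_posDef_mul_self_mul_eq_one
  have hAB : Vᴴ * σ * V * (B * B) = 1 := mul_eq_one_comm.1 hBA
  have hσH : σᴴ = σ := hσ.1
  have hBH : Bᴴ = B := hB.1
  set Q : Matrix ι ι ℂ := 1 - V * Vᴴ with hQ
  have hQH : Qᴴ = Q := by simp [hQ]
  have hQV : Q * V = 0 := by rw [hQ, Matrix.sub_mul, Matrix.mul_assoc, hV]; simp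
  have hQQ : Qᴴ * Q = Q := by
    rw [hQH]; nth_rw 2 [hQ]; rw [Matrix.mul_sub, ← Matrix.mul_assoc, hQV]; simp
  set R : Matrix ι ι ℂ := (σ * V * B) * B * (σ * V * B)ᴴ + Q with hR
  have hR0 : R.PosSemidef :=
    (hB.posSemidef.mul_mul_conjTranspose_same _).add (hQQ ▸ posSemidef_conjTranspose_mul_self Q)
  have hRH : Rᴴ = R := hR0.1
  have hRV : R * V = σ * V * B := by
    calc R * V = σ * V * B * (B * B * (Vᴴ * σ * V)) + Q * V := by
          simp only [hR, conjTranspose_mul, hσH, hBH, Matrix.add_mul, Matrix.mul_assoc]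
      _ = σ * V * B := by rw [hBA, hQV]; simp
  have hVR : Vᴴ * R = B * Vᴴ * σ := by
    simpa [conjTranspose_mul, hRH, hσH, hBH, Matrix.mul_assoc] using congrArg (fun M => Mᴴ) hRV
  refine ⟨R, hR0.posDef_iff_isUnit.2 (mulVec_injective_iff_isUnit.1 ?_), ?_⟩
  · refine (injective_iff_map_eq_zero R.mulVecLin).2 fun x hx => ?_
    rw [mulVecLin_apply] at hx
    have h1 : (Vᴴ * σ) *ᵥ x = 0 := by
      have : (Vᴴ * σ * V * B) *ᵥ ((Vᴴ * R) *ᵥ x) = (Vᴴ * σ) *ᵥ x := by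
        rw [hVR, mulVec_mulVec]
        congr 1
        calc Vᴴ * σ * V * B * (B * Vᴴ * σ) = Vᴴ * σ * V * (B * B) * (Vᴴ * σ) := by
              simp only [Matrix.mul_assoc]
          _ = Vᴴ * σ := by rw [hAB, Matrix.one_mul]
      rw [← this, ← mulVec_mulVec x Vᴴ R, hx]; simp
    have h2 : Q *ᵥ x = 0 := by
      have : R *ᵥ x = (σ * V * B * B * B) *ᵥ ((Vᴴ * σ) *ᵥ x) + Q *ᵥ x := by
        rw [mulVec_mulVec, ← add_mulVec]
        simp only [hR, conjTranspose_mul, hσH, hBH, Matrix.mul_assoc]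
      simpa [hx, h1] using this.symm
    have h3 : x = V *ᵥ (Vᴴ *ᵥ x) := by
      simpa [hQ, sub_mulVec, sub_eq_zero, mulVec_mulVec] using h2
    have h4 : (Vᴴ * σ * V) *ᵥ (Vᴴ *ᵥ x) = 0 := by
      rw [← mulVec_mulVec, ← h3, h1]
    have h5 : Vᴴ *ᵥ x = 0 := by
      rw [← one_mulVec (Vᴴ *ᵥ x), ← hBA, ← mulVec_mulVec, h4, mulVec_zero]
    rw [h3, h5, mulVec_zero]
  · set N : Matrix ι ι ℂ := V * (B * B) * Vᴴ with hN
    have hNH : Nᴴ = N := by simp [hN, conjTranspose_mul, hBH, Matrix.mul_assoc]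
    have hNN : N * σ * N = N := by
      calc N * σ * N = V * (B * B * (Vᴴ * σ * V)) * (B * B) * Vᴴ := by
            simp only [hN, Matrix.mul_assoc]
        _ = N := by rw [hBA, Matrix.mul_one]
    have hRR : R * (V * Vᴴ) * R = σ * N * σ := by
      calc R * (V * Vᴴ) * R = (R * V) * (Vᴴ * R) := by simp only [Matrix.mul_assoc]
        _ = σ * N * σ := by rw [hRV, hVR]; simp only [hN, Matrix.mul_assoc]
    have key : (1 - N * σ)ᴴ * σ * (1 - N * σ) = σ - R * (V * Vᴴ) * R := by
      rw [hRR, conjTranspose_sub, conjTranspose_mul, hNH, hσH, conjTranspose_one]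
      calc (1 - σ * N) * σ * (1 - N * σ)
          = σ - σ * N * σ - σ * N * σ + σ * (N * σ * N) * σ := by noncomm_ring
        _ = σ - σ * N * σ := by rw [hNN]; abel
    exact key ▸ hσ.conjTranspose_mul_mul_same _

theorem AbsContWrt.exists_posDef_sandwich_le {ι : Type*} [Fintype ι] [DecidableEq ι]
    {ρ σ : Matrix ι ι ℂ} (hρ : ρ.PosSemidef) (hσ : σ.PosSemidef) (h : AbsContWrt ρ σ) :
    ∃ R : Matrix ι ι ℂ, R.PosDef ∧ (σ - R * ρ * R).PosSemidef := by
  obtain ⟨p, _, V, d, hd, hV, hρV⟩ := hρ.exists_isometry_mul_diagonal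
  have hA : (Vᴴ * σ * V).PosDef := by
    refine .of_dotProduct_mulVec_pos (isHermitian_conjTranspose_mul_mul V hσ.1) fun z hz => ?_
    have hVz : V *ᵥ z ≠ 0 := fun h0 => hz <| by
      rw [← one_mulVec z, ← hV, ← mulVec_mulVec, h0, mulVec_zero]
    have hpos := h (V *ᵥ z) ⟨V *ᵥ fun i => (d i : ℂ)⁻¹ * z i, by
      have : (diagonal fun i => (d i : ℂ)) *ᵥ (fun i => (d i : ℂ)⁻¹ * z i) = z := by
        ext i
        rw [mulVec_diagonal, mul_inv_cancel_left₀ (by exact_mod_cast (hd i).ne')]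
      rw [hρV, mulVec_mulVec, Matrix.mul_assoc, hV, Matrix.mul_one, ← mulVec_mulVec, this]⟩ hVz
    have heq : star z ⬝ᵥ (Vᴴ * σ * V) *ᵥ z = star (V *ᵥ z) ⬝ᵥ σ *ᵥ (V *ᵥ z) := by
      simp only [star_mulVec, dotProduct_mulVec, vecMul_vecMul, Matrix.mul_assoc]
    rw [heq]
    exact (hσ.dotProduct_mulVec_nonneg _).lt_of_ne' fun h0 => hpos.ne' (by rw [h0, Complex.zero_re])
  obtain ⟨R, hR, hRσ⟩ := hσ.exists_posDef_sandwich_le hV hA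
  set c : ℝ := 1 + ∑ i, d i
  have hc : 0 < c := by
    have := Finset.sum_nonneg fun i (_ : i ∈ Finset.univ) => (hd i).le
    positivity
  have hdc : ∀ i, d i ≤ c := fun i =>
    (Finset.single_le_sum (fun j _ => (hd j).le) (Finset.mem_univ i)).trans (by simp [c])
  have hρc : (V * Vᴴ - c⁻¹ • ρ).PosSemidef := by
    have hD : (diagonal fun i => ((1 - c⁻¹ * d i : ℝ) : ℂ)).PosSemidef := by
      refine .diagonal fun i => ?_
      have : c⁻¹ * d i ≤ 1 := by
        rw [inv_mul_le_iff₀ hc, mul_one]; exact hdc i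
      exact Complex.zero_le_real.2 (sub_nonneg.2 this)
    have hDeq : (diagonal fun i => ((1 - c⁻¹ * d i : ℝ) : ℂ))
        = 1 - c⁻¹ • diagonal fun i => (d i : ℂ) := by
      rw [← diagonal_one, ← diagonal_smul, diagonal_sub]
      congr 1; ext i; simp
    have := hD.mul_mul_conjTranspose_same V
    rw [hDeq, Matrix.mul_sub, Matrix.sub_mul, Matrix.mul_one, Matrix.mul_smul,
      Matrix.smul_mul, ← hρV] at this
    exact this
  have hs : (√c)⁻¹ * (√c)⁻¹ = c⁻¹ := by rw [← mul_inv, Real.mul_self_sqrt hc.le]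
  refine ⟨(√c)⁻¹ • R, hR.smul (inv_pos.2 (Real.sqrt_pos.2 hc)), ?_⟩
  have hsum := hRσ.add (hρc.conjTranspose_mul_mul_same R)
  have heq : σ - R * (V * Vᴴ) * R + Rᴴ * (V * Vᴴ - c⁻¹ • ρ) * R
      = σ - (√c)⁻¹ • R * ρ * (√c)⁻¹ • R := by
    rw [hR.1.eq]
    simp only [Matrix.smul_mul, Matrix.mul_smul, smul_smul, hs, Matrix.mul_sub, Matrix.sub_mul]
    abel
  exact heq ▸ hsum

theorem AbsContWrt.of_sandwich_le {ι : Type*} [Fintype ι] [DecidableEq ι]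
    {ρ σ R : Matrix ι ι ℂ} (hρ : ρ.PosSemidef) (hσ : σ.PosSemidef) (hR : R.PosDef)
    (h : (σ - R * ρ * R).PosSemidef) : AbsContWrt ρ σ := by
  rintro x ⟨y, rfl⟩ hx
  set x := ρ *ᵥ y with hxy
  refine (Complex.nonneg_iff.1 (hσ.dotProduct_mulVec_nonneg x)).1.lt_of_ne' fun h0 => hx ?_
  have hσx : star x ⬝ᵥ σ *ᵥ x = 0 :=
    Complex.ext h0 (Complex.nonneg_iff.1 (hσ.dotProduct_mulVec_nonneg x)).2.symm
  have hRx : star x ⬝ᵥ (R * ρ * R) *ᵥ x = star (R *ᵥ x) ⬝ᵥ ρ *ᵥ (R *ᵥ x) := by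
    simp only [star_mulVec, hR.1.eq, dotProduct_mulVec, vecMul_vecMul, Matrix.mul_assoc]
  have hle := h.dotProduct_mulVec_nonneg x
  rw [sub_mulVec, dotProduct_sub, hσx, zero_sub, hRx, neg_nonneg] at hle
  have hρRx : ρ *ᵥ (R *ᵥ x) = 0 :=
    (hρ.dotProduct_mulVec_zero_iff _).1 (hle.antisymm (hρ.dotProduct_mulVec_nonneg _))
  by_contra hx0
  refine (hR.dotProduct_mulVec_pos hx0).ne' ?_
  rw [hxy, star_mulVec, hρ.1.eq, ← dotProduct_mulVec, ← hxy, hρRx, dotProduct_zero]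

/-- Conjugating by `R⁻¹` turns `R * ρ * R ≤ σ` into `ρ ≤ R⁻¹ * σ * R⁻¹`. -/
theorem exists_posDef_sandwich_le_iff {ι : Type*} [Fintype ι] [DecidableEq ι]
    (ρ σ : Matrix ι ι ℂ) :
    (∃ R : Matrix ι ι ℂ, R.PosDef ∧ (σ - R * ρ * R).PosSemidef) ↔
      ∃ R : Matrix ι ι ℂ, R.PosDef ∧ (R * σ * R - ρ).PosSemidef := by
  constructor
  · rintro ⟨R, hR, h⟩
    have hdet := (isUnit_iff_isUnit_det R).1 hR.isUnit
    refine ⟨R⁻¹, hR.inv, ?_⟩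
    have := h.conjTranspose_mul_mul_same R⁻¹
    rw [hR.inv.1.eq, Matrix.mul_sub, Matrix.sub_mul] at this
    simpa [Matrix.mul_assoc, mul_nonsing_inv _ hdet, nonsing_inv_mul_cancel_left _ _ hdet] using this
  · rintro ⟨R, hR, h⟩
    have hdet := (isUnit_iff_isUnit_det R).1 hR.isUnit
    refine ⟨R⁻¹, hR.inv, ?_⟩
    have := h.conjTranspose_mul_mul_same R⁻¹
    rw [hR.inv.1.eq, Matrix.mul_sub, Matrix.sub_mul] at this
    simpa [Matrix.mul_assoc, mul_nonsing_inv _ hdet, nonsing_inv_mul_cancel_left _ _ hdet] using this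

/-- Lemma 2.2 (a) ⇔ (b) ⇔ (c): `ρ ≪ σ` iff `σ ≥ RρR` for some positive definite `R`,
iff `ρ ≤ RσR` for some positive definite `R`. -/
theorem stmt_1 {ι : Type*} [Fintype ι] [DecidableEq ι]
    (ρ σ : Matrix ι ι ℂ) (hρ : ρ.PosSemidef) (hσ : σ.PosSemidef)
    (hρ0 : ρ ≠ 0) (hσ0 : σ ≠ 0) :
    (AbsContWrt ρ σ ↔ ∃ R : Matrix ι ι ℂ, R.PosDef ∧ (σ - R * ρ * R).PosSemidef) ∧
    (AbsContWrt ρ σ ↔ ∃ R : Matrix ι ι ℂ, R.PosDef ∧ (R * σ * R - ρ).PosSemidef) := by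
  have key : AbsContWrt ρ σ ↔ ∃ R : Matrix ι ι ℂ, R.PosDef ∧ (σ - R * ρ * R).PosSemidef :=
    ⟨fun h => h.exists_posDef_sandwich_le hρ hσ, fun ⟨_, hR, h⟩ => .of_sandwich_le hρ hσ hR h⟩
  exact ⟨key, key.trans (exists_posDef_sandwich_le_iff ρ σ)⟩
end

section
/- Let ρ and σ be nonzero positive semidefinite operators on a finite-dimensional complex inner product space H. Then ρ is absolutely continuous with respect to σ (ρ ≪ σ) if and only if there exists a positive semidefinite operator R on H with ρ = R σ R. -/
open Matrix
open scoped Matrix ComplexOrder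

section InvSqrt

open scoped MatrixOrder

/-- A positive semidefinite matrix has a positive semidefinite generalized inverse square root. -/
theorem Matrix.PosSemidef.exists_generalized_inv_sqrt {ι : Type*} [Fintype ι] [DecidableEq ι]
    {M : Matrix ι ι ℂ} (hM : M.PosSemidef) :
    ∃ N : Matrix ι ι ℂ, N.PosSemidef ∧ M * N = N * M ∧ M * N * (M * N) = M := by
  have hsa : IsSelfAdjoint M := hM.isHermitian
  have hfin : (spectrum ℝ M).Finite := M.finite_real_spectrum
  have hc : ContinuousOn (fun x : ℝ => (√x)⁻¹) (spectrum ℝ M) := hfin.continuousOn _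
  have hN : M * cfc (fun x : ℝ => (√x)⁻¹) M = cfc (fun x : ℝ => x * (√x)⁻¹) M := by
    rw [cfc_mul (fun x : ℝ => x) (fun x : ℝ => (√x)⁻¹) M continuousOn_id hc, cfc_id' ℝ M]
  have hc' : ContinuousOn (fun x : ℝ => x * (√x)⁻¹) (spectrum ℝ M) := hfin.continuousOn _
  refine ⟨cfc (fun x : ℝ => (√x)⁻¹) M, ?_, ?_, ?_⟩
  · rw [← Matrix.nonneg_iff_posSemidef]
    exact cfc_nonneg fun x _ => by positivity
  · simpa only [cfc_id' ℝ M hsa] using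
      (cfc_commute_cfc (fun x : ℝ => x) (fun x : ℝ => (√x)⁻¹) M).eq
  · rw [hN, ← cfc_mul _ _ M hc' hc']
    conv_rhs => rw [← cfc_id' ℝ M hsa]
    refine cfc_congr fun x hx => ?_
    have hx0 : 0 ≤ x := spectrum_nonneg_of_nonneg hM.nonneg hx
    rcases hx0.eq_or_lt with rfl | hpos
    · simp
    · have := Real.sq_sqrt hx0
      have hs : √x ≠ 0 := (Real.sqrt_pos.2 hpos).ne'
      field_simp
      rw [this]

end InvSqrt

theorem Matrix.PosSemidef.mulVec_eq_zero_of_re_le_zero {ι : Type*} [Fintype ι] {M : Matrix ι ι ℂ}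
    (hM : M.PosSemidef) {x : ι → ℂ} (h : (star x ⬝ᵥ M.mulVec x).re ≤ 0) : M.mulVec x = 0 := by
  refine (hM.dotProduct_mulVec_zero_iff x).1 ?_
  have h0 := Complex.le_def.1 (hM.dotProduct_mulVec_nonneg x)
  exact Complex.ext (le_antisymm h h0.1) h0.2.symm

/-- Lemma 2.2 (a) ⇔ (d): `ρ ≪ σ` iff `ρ = RσR` for some positive semidefinite `R`. -/
theorem stmt_2 {ι : Type*} [Fintype ι] [DecidableEq ι]
    (ρ σ : Matrix ι ι ℂ) (hρ : ρ.PosSemidef) (hσ : σ.PosSemidef)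
    (hρ0 : ρ ≠ 0) (hσ0 : σ ≠ 0) :
    AbsContWrt ρ σ ↔ ∃ R : Matrix ι ι ℂ, R.PosSemidef ∧ ρ = R * σ * R := by
  constructor
  · intro h
    obtain ⟨S, hS, hcomm, hsq⟩ := hρ.exists_generalized_inv_sqrt
    set A := ρ * S with hA
    have hAh : Aᴴ = A := by
      rw [hA, conjTranspose_mul, hS.isHermitian.eq, hρ.isHermitian.eq, ← hcomm]
    have hM : (A * σ * A).PosSemidef := by
      simpa [hAh] using hσ.mul_mul_conjTranspose_same A
    obtain ⟨N, hN, _, hNsq⟩ := hM.exists_generalized_inv_sqrt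
    have hker : ∀ v, (A * σ * A).mulVec v = 0 → A.mulVec v = 0 := by
      intro v hv
      by_contra hne
      refine (h (A.mulVec v) ⟨S.mulVec v, by rw [hA, mulVec_mulVec]⟩ hne).ne' ?_
      have : star (A.mulVec v) ⬝ᵥ σ.mulVec (A.mulVec v)
          = star v ⬝ᵥ (A * σ * A).mulVec v := by
        rw [star_mulVec, hAh, ← dotProduct_mulVec, mulVec_mulVec, mulVec_mulVec, ← mul_assoc]
      rw [this, hv, dotProduct_zero, Complex.zero_re]
    have hAP : A * (N * (A * σ * A) * N) = A := by
      rw [← sub_eq_zero]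
      refine Matrix.ext_of_mulVec_single fun i => ?_
      rw [zero_mulVec, ← mul_one A, mul_assoc A 1, one_mul, ← mul_sub, ← mulVec_mulVec, mul_one]
      apply hker
      rw [mulVec_mulVec, mul_sub, mul_one, mul_assoc N, ← mul_assoc, ← mul_assoc _ _ N, mul_assoc,
        hNsq, sub_self, zero_mulVec]
    refine ⟨A * N * A, by simpa [hAh] using hN.mul_mul_conjTranspose_same A, ?_⟩
    calc ρ = A * A := hsq.symm
      _ = A * (N * (A * σ * A) * N) * A := by rw [hAP]
      _ = A * N * A * σ * (A * N * A) := by simp only [mul_assoc]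
  · rintro ⟨R, hR, hρR⟩ x ⟨y, rfl⟩ hx
    by_contra! hle
    have hσx := hσ.mulVec_eq_zero_of_re_le_zero hle
    have hxz : ρ.mulVec y = R.mulVec (σ.mulVec (R.mulVec y)) := by
      rw [hρR, mulVec_mulVec, mulVec_mulVec, mul_assoc]
    refine hx (hxz.trans (hR.mulVec_eq_zero_of_re_le_zero (le_of_eq ?_)))
    rw [← hxz, star_mulVec, hσ.isHermitian.eq, ← dotProduct_mulVec, hσx, dotProduct_zero,
      Complex.zero_re]
end

section
/- Let ρ and σ be nonzero positive semidefinite operators on a finite-dimensional complex inner product space H. Then ρ is absolutely continuous with respect to σ (ρ ≪ σ) if and only if there exists a positive semidefinite operator R on H with R σ R ≤ ρ and Tr ρ = Tr(σ R²). -/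
open Matrix
open scoped Matrix ComplexOrder

namespace Matrix

variable {ι : Type*} [Fintype ι] [DecidableEq ι]

open scoped MatrixOrder in
/-- A positive semidefinite matrix has a positive semidefinite square root. -/
lemma PosSemidef.exists_posSemidef_mul_self {A : Matrix ι ι ℂ} (hA : A.PosSemidef) :
    ∃ S : Matrix ι ι ℂ, S.PosSemidef ∧ S * S = A :=
  ⟨CFC.sqrt A, nonneg_iff_posSemidef.mp (CFC.sqrt_nonneg A),
    CFC.sqrt_mul_sqrt_self A (nonneg_iff_posSemidef.mpr hA)⟩

open scoped MatrixOrder in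
/-- For a Hermitian matrix `A`, there is a positive semidefinite matrix that annihilates `A` and
whose complement factors through `A` (namely the orthogonal projection onto the kernel). -/
lemma IsHermitian.exists_posSemidef_mul_eq_zero {A : Matrix ι ι ℂ} (hA : A.IsHermitian) :
    ∃ P B : Matrix ι ι ℂ, P.PosSemidef ∧ P * A = 0 ∧ A * B + P = 1 := by
  have hA' : IsSelfAdjoint A := hA
  have hc (f : ℝ → ℝ) : ContinuousOn f (spectrum ℝ A) :=
    (finite_real_spectrum (A := A)).continuousOn f
  refine ⟨cfc (fun x : ℝ ↦ if x = 0 then 1 else 0) A, cfc (fun x : ℝ ↦ x⁻¹) A, ?_, ?_, ?_⟩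
  · exact nonneg_iff_posSemidef.mp (cfc_nonneg fun x _ ↦ by split_ifs <;> norm_num)
  · nth_rw 2 [← cfc_id' ℝ A]
    rw [← cfc_mul _ _ A (hc _) (hc _), ← cfc_const_zero ℝ A]
    exact cfc_congr fun x _ ↦ by by_cases h : x = 0 <;> simp [h]
  · nth_rw 1 [← cfc_id' ℝ A]
    rw [← cfc_mul _ _ A (hc _) (hc _), ← cfc_add A _ _ (hc _) (hc _), ← cfc_const_one ℝ A]
    exact cfc_congr fun x _ ↦ by by_cases h : x = 0 <;> simp [h]

/-- For `T` positive definite and `A` positive semidefinite, the equation `R * T * R = A` has a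
positive semidefinite solution. -/
lemma PosDef.exists_posSemidef_mul_mul_eq {T A : Matrix ι ι ℂ} (hT : T.PosDef)
    (hA : A.PosSemidef) : ∃ R : Matrix ι ι ℂ, R.PosSemidef ∧ R * T * R = A := by
  obtain ⟨S, hS, rfl⟩ := hT.posSemidef.exists_posSemidef_mul_self
  have hSu : IsUnit S.det := (isUnit_iff_isUnit_det S).mp (isUnit_of_mul_isUnit_left hT.isUnit)
  have hSA : (S * A * S).PosSemidef := by
    simpa only [hS.isHermitian.eq] using hA.mul_mul_conjTranspose_same S
  obtain ⟨W, hW, hWS⟩ := hSA.exists_posSemidef_mul_self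
  refine ⟨S⁻¹ * W * S⁻¹, ?_, ?_⟩
  · simpa only [hS.inv.isHermitian.eq] using hW.mul_mul_conjTranspose_same S⁻¹
  · calc S⁻¹ * W * S⁻¹ * (S * S) * (S⁻¹ * W * S⁻¹)
        = S⁻¹ * W * (S⁻¹ * S) * (S * S⁻¹) * W * S⁻¹ := by simp only [mul_assoc]
      _ = S⁻¹ * (W * W) * S⁻¹ := by
        rw [nonsing_inv_mul S hSu, mul_nonsing_inv S hSu]; simp only [mul_assoc, mul_one]
      _ = (S⁻¹ * S) * A * (S * S⁻¹) := by rw [hWS]; simp only [mul_assoc]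
      _ = A := by rw [nonsing_inv_mul S hSu, mul_nonsing_inv S hSu, mul_one, one_mul]

/-- If `T` is positive definite and `Xᴴ * T * X = 0`, then `X = 0`. -/
lemma PosDef.eq_zero_of_conjTranspose_mul_mul_same {T X : Matrix ι ι ℂ} (hT : T.PosDef)
    (h : Xᴴ * T * X = 0) : X = 0 := by
  refine ext_of_mulVec_single fun i ↦ ?_
  rw [zero_mulVec]
  by_contra hx
  refine (hT.dotProduct_mulVec_pos hx).ne' ?_
  rw [star_mulVec, ← dotProduct_mulVec, mulVec_mulVec, mulVec_mulVec, h, zero_mulVec, dotProduct_zero]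

end Matrix

section

variable {ι : Type*} [Fintype ι] [DecidableEq ι] {ρ σ : Matrix ι ι ℂ}

/-- If `ρ ≪ σ`, then `ρ = R σ R` for some positive semidefinite `R`. -/
lemma AbsContWrt.exists_posSemidef_mul_mul_eq (hρ : ρ.PosSemidef) (hσ : σ.PosSemidef)
    (h : AbsContWrt ρ σ) : ∃ R : Matrix ι ι ℂ, R.PosSemidef ∧ R * σ * R = ρ := by
  obtain ⟨P, B, hP, hPρ, hB⟩ := hρ.isHermitian.exists_posSemidef_mul_eq_zero
  have hT : (σ + P).PosDef := by
    refine .of_dotProduct_mulVec_pos (hσ.isHermitian.add hP.isHermitian) fun x hx ↦ ?_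
    have h1 := hσ.dotProduct_mulVec_nonneg x
    have h2 := hP.dotProduct_mulVec_nonneg x
    rw [add_mulVec, dotProduct_add]
    refine (add_nonneg h1 h2).lt_of_ne' fun h0 ↦ ?_
    obtain ⟨h1', h2'⟩ := (add_eq_zero_iff_of_nonneg h1 h2).mp h0
    have hPx := (hP.dotProduct_mulVec_zero_iff x).mp h2'
    have hxρ : ρ.mulVec (B.mulVec x) = x := by
      have := congrArg (·.mulVec x) hB
      simpa [add_mulVec, hPx, ← mulVec_mulVec] using this
    simpa [h1'] using h x ⟨_, hxρ⟩ hx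
  obtain ⟨R, hR, hRT⟩ := hT.exists_posSemidef_mul_mul_eq hρ
  have hRP : R * P = 0 := hT.eq_zero_of_conjTranspose_mul_mul_same <| by
    rw [conjTranspose_mul, hR.isHermitian.eq, hP.isHermitian.eq]
    calc P * R * (σ + P) * (R * P) = P * (R * (σ + P) * R) * P := by simp only [mul_assoc]
      _ = 0 := by rw [hRT, hPρ, zero_mul]
  refine ⟨R, hR, ?_⟩
  rw [← hRT, mul_add, hRP, add_zero]

/-- If `R` and `σ` are positive semidefinite, then `R σ R ≪ σ`. -/
lemma Matrix.PosSemidef.absContWrt_mul_mul {R : Matrix ι ι ℂ} (hR : R.PosSemidef)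
    (hσ : σ.PosSemidef) : AbsContWrt (R * σ * R) σ := by
  rintro x ⟨y, rfl⟩ hx
  refine (Complex.lt_def.mp ((hσ.dotProduct_mulVec_nonneg _).lt_of_ne' fun h0 ↦ hx ?_)).1
  replace h0 := (hσ.dotProduct_mulVec_zero_iff _).mp h0
  have h1 : R.mulVec ((σ * R).mulVec y) = 0 := by
    refine (hR.dotProduct_mulVec_zero_iff _).mp ?_
    calc star ((σ * R).mulVec y) ⬝ᵥ R.mulVec ((σ * R).mulVec y)
        = star y ⬝ᵥ R.mulVec (σ.mulVec ((R * σ * R).mulVec y)) := by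
          simp only [star_mulVec, conjTranspose_mul, hR.isHermitian.eq, hσ.isHermitian.eq,
            ← dotProduct_mulVec, mulVec_mulVec, mul_assoc]
      _ = 0 := by rw [h0, mulVec_zero, dotProduct_zero]
  rwa [mul_assoc, ← mulVec_mulVec]

end

/-- Lemma 2.2 (a) ⇔ (e): `ρ ≪ σ` iff there is a positive semidefinite `R` with
`R σ R ≤ ρ` and `Tr ρ = Tr (σ R²)`. -/
theorem stmt_3 {ι : Type*} [Fintype ι] [DecidableEq ι]
    (ρ σ : Matrix ι ι ℂ) (hρ : ρ.PosSemidef) (hσ : σ.PosSemidef)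
    (hρ0 : ρ ≠ 0) (hσ0 : σ ≠ 0) :
    AbsContWrt ρ σ ↔
      ∃ R : Matrix ι ι ℂ, R.PosSemidef ∧ (ρ - R * σ * R).PosSemidef ∧
        ρ.trace = (σ * (R * R)).trace := by
  constructor
  · intro h
    obtain ⟨R, hR, rfl⟩ := h.exists_posSemidef_mul_mul_eq hρ hσ
    refine ⟨R, hR, ?_, ?_⟩
    · rw [sub_self]
      exact .zero
    · rw [trace_mul_cycle, trace_mul_comm]
  · rintro ⟨R, hR, hle, htr⟩
    have h0 : ρ - R * σ * R = 0 := hle.trace_eq_zero_iff.mp <| by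
      rw [trace_sub, htr, trace_mul_cycle R, trace_mul_comm σ, sub_self]
    rw [sub_eq_zero.mp h0]
    exact hR.absContWrt_mul_mul hσ
end

section
/- Let ρ be a nonzero positive semidefinite operator and σ a positive semidefinite operator on a finite-dimensional complex inner product space H. Then there exist positive semidefinite operators R and τ on H such that σ = R ρ R + τ and Tr(ρ τ) = 0 (i.e., τ is singular with respect to ρ). In particular, every positive semidefinite σ admits a quantum Lebesgue decomposition σ = σ^{ac} + σ^{⊥} with σ^{ac} = R ρ R absolutely continuous with respect to ρ (or zero) and σ^{⊥} = τ singular with respect to ρ. -/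
open Matrix
open scoped Matrix ComplexOrder

lemma Matrix.PosSemidef.exists_eq_conjTranspose_mul_self {ι : Type*} [Fintype ι] [DecidableEq ι]
    {A : Matrix ι ι ℂ} (hA : A.PosSemidef) : ∃ B : Matrix ι ι ℂ, A = Bᴴ * B := by
  open scoped MatrixOrder Matrix.Norms.L2Operator in
  exact CStarAlgebra.nonneg_iff_eq_star_mul_self.1 hA.nonneg

lemma Matrix.PosSemidef.exists_eq_mul_diagonal_mul_conjTranspose
    {ι : Type*} [Fintype ι] [DecidableEq ι] {A : Matrix ι ι ℂ} (hA : A.PosSemidef) :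
    ∃ (U : Matrix ι ι ℂ) (d : ι → ℝ), Uᴴ * U = 1 ∧ (∀ i, 0 ≤ d i) ∧
      A = U * diagonal (fun i ↦ (d i : ℂ)) * Uᴴ := by
  refine ⟨hA.1.eigenvectorUnitary, hA.1.eigenvalues, Unitary.coe_star_mul_self _,
    hA.eigenvalues_nonneg, ?_⟩
  have h := hA.1.spectral_theorem
  rwa [Unitary.conjStarAlgAut_apply] at h

/-- A positive semidefinite matrix `D` has a Hermitian pseudoinverse `E`, and a positive semidefinite
`K` (the power `D ^ (-3 / 2)` on the support of `D`) with `K * D * D * K = E`. -/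
lemma Matrix.PosSemidef.exists_pseudoinverse {ι : Type*} [Fintype ι] [DecidableEq ι]
    {D : Matrix ι ι ℂ} (hD : D.PosSemidef) :
    ∃ E K : Matrix ι ι ℂ, E.IsHermitian ∧ K.PosSemidef ∧ D * E * D = D ∧ E * D * E = E ∧
      K * D * D * K = E := by
  obtain ⟨U, d, hUU, hd, rfl⟩ := hD.exists_eq_mul_diagonal_mul_conjTranspose
  obtain ⟨F, hF⟩ : ∃ F : (ℝ → ℝ) → Matrix ι ι ℂ,
      ∀ f, F f = U * diagonal (fun i ↦ ((f (d i) : ℝ) : ℂ)) * Uᴴ := ⟨_, fun _ ↦ rfl⟩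
  rw [show U * diagonal (fun i ↦ (d i : ℂ)) * Uᴴ = F id from (hF id).symm]
  have hmul (f g : ℝ → ℝ) : F f * F g = F (f * g) := by
    calc F f * F g = U * (diagonal (fun i ↦ ((f (d i) : ℝ) : ℂ)) * (Uᴴ * U) *
            diagonal (fun i ↦ ((g (d i) : ℝ) : ℂ))) * Uᴴ := by
          simp only [hF, Matrix.mul_assoc]
      _ = F (f * g) := by simp [hF, hUU, diagonal_mul_diagonal]
  have hcongr {f g : ℝ → ℝ} (h : ∀ x, 0 ≤ x → f x = g x) : F f = F g := by
    simp only [hF, h _ (hd _)]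
  have hpos {f : ℝ → ℝ} (h : ∀ x, 0 ≤ x → 0 ≤ f x) : (F f).PosSemidef := by
    rw [hF]
    refine (PosSemidef.diagonal fun i ↦ ?_).mul_mul_conjTranspose_same U
    exact Complex.zero_le_real.2 (h _ (hd i))
  refine ⟨F fun x ↦ x⁻¹, F fun x ↦ x⁻¹ * (√x)⁻¹, (hpos fun x hx ↦ inv_nonneg.2 hx).1,
    hpos fun x hx ↦ by positivity, ?_, ?_, ?_⟩
  · rw [hmul, hmul]
    exact hcongr fun x _ ↦ by simp
  · rw [hmul, hmul]
    exact hcongr fun x _ ↦ by simpa using mul_inv_mul_cancel x⁻¹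
  · rw [hmul, hmul, hmul]
    refine hcongr fun x hx ↦ ?_
    rcases hx.eq_or_lt with rfl | hx
    · simp
    · have h := Real.sq_sqrt hx.le
      have := Real.sqrt_pos.2 hx
      simp only [Pi.mul_apply, id]
      field_simp
      exact h.symm

/-- Existence of the quantum Lebesgue decomposition: `σ = R ρ R + τ` with `R, τ`
positive semidefinite and `τ` singular with respect to `ρ` (`Tr (ρτ) = 0`);
the absolutely continuous part `R ρ R` is absolutely continuous w.r.t. `ρ` or zero. -/
theorem stmt_4 {ι : Type*} [Fintype ι] [DecidableEq ι]
    (ρ σ : Matrix ι ι ℂ) (hρ : ρ.PosSemidef) (hρ0 : ρ ≠ 0) (hσ : σ.PosSemidef) :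
    ∃ R τ : Matrix ι ι ℂ, R.PosSemidef ∧ τ.PosSemidef ∧
      σ = R * ρ * R + τ ∧ (ρ * τ).trace = 0 ∧
      (R * ρ * R = 0 ∨ AbsContWrt (R * ρ * R) ρ) := by
  obtain ⟨B, rfl⟩ := hρ.exists_eq_conjTranspose_mul_self
  obtain ⟨q, hq⟩ := hσ.exists_eq_conjTranspose_mul_self
  obtain ⟨E, K, hE, hK, hDED, hEDE, hKDDK⟩ :=
    (hσ.mul_mul_conjTranspose_same B).exists_pseudoinverse
  have hac : (σ * Bᴴ * K * B * σ) * (Bᴴ * B) * (σ * Bᴴ * K * B * σ) = σ * Bᴴ * E * B * σ := by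
    rw [← hKDDK]
    simp only [Matrix.mul_assoc]
  have hτ : σ - σ * Bᴴ * E * B * σ =
      ((1 - q * Bᴴ * E * B * qᴴ) * q)ᴴ * ((1 - q * Bᴴ * E * B * qᴴ) * q) := by
    have hidem : (q * Bᴴ * E * B * qᴴ) * (q * Bᴴ * E * B * qᴴ) = q * Bᴴ * E * B * qᴴ := by
      calc _ = q * Bᴴ * (E * (B * (qᴴ * q) * Bᴴ) * E) * B * qᴴ := by simp only [Matrix.mul_assoc]
        _ = _ := by rw [← hq, hEDE]
    have hherm : (q * Bᴴ * E * B * qᴴ)ᴴ = q * Bᴴ * E * B * qᴴ := by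
      simp [conjTranspose_mul, hE.eq, Matrix.mul_assoc]
    have hproj : (1 - q * Bᴴ * E * B * qᴴ) * (1 - q * Bᴴ * E * B * qᴴ) =
        1 - q * Bᴴ * E * B * qᴴ := by
      rw [Matrix.mul_sub, Matrix.sub_mul, Matrix.sub_mul, hidem]
      simp
    calc _ = qᴴ * (1 - q * Bᴴ * E * B * qᴴ) * q := by
          rw [hq]
          simp only [Matrix.mul_sub, Matrix.sub_mul, Matrix.mul_assoc, Matrix.mul_one]
      _ = _ := by
          rw [conjTranspose_mul, conjTranspose_sub, conjTranspose_one, hherm]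
          conv_lhs => rw [← hproj]
          simp only [Matrix.mul_assoc]
  refine ⟨σ * Bᴴ * K * B * σ, σ - σ * Bᴴ * E * B * σ, ?_, ?_, ?_, ?_, Or.inr ?_⟩
  · have h := hK.conjTranspose_mul_mul_same (B * σ)
    rwa [conjTranspose_mul, hσ.1.eq, ← Matrix.mul_assoc] at h
  · rw [hτ]
    exact posSemidef_conjTranspose_mul_self _
  · rw [hac, add_sub_cancel]
  · calc _ = (B * (σ - σ * Bᴴ * E * B * σ) * Bᴴ).trace := by
          rw [Matrix.mul_assoc, trace_mul_comm]
      _ = (B * σ * Bᴴ - B * σ * Bᴴ * E * (B * σ * Bᴴ)).trace := by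
          simp only [Matrix.mul_sub, Matrix.sub_mul, Matrix.mul_assoc]
      _ = 0 := by rw [hDED, sub_self, trace_zero]
  · rw [hac]
    rintro x ⟨y, rfl⟩ hx
    have hnonneg := hρ.dotProduct_mulVec_nonneg ((σ * Bᴴ * E * B * σ) *ᵥ y)
    refine (Complex.le_def.1 hnonneg).1.lt_of_ne fun h ↦ hx ?_
    have h0 := (Complex.ext h (Complex.le_def.1 hnonneg).2).symm
    have hB : B *ᵥ ((σ * Bᴴ * E * B * σ) *ᵥ y) = 0 := by
      rw [hρ.dotProduct_mulVec_zero_iff] at h0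
      rwa [conjTranspose_mul_self_mulVec_eq_zero] at h0
    calc (σ * Bᴴ * E * B * σ) *ᵥ y
        = (σ * Bᴴ * (E * (B * σ * Bᴴ) * E) * B * σ) *ᵥ y := by rw [hEDE]
      _ = (σ * Bᴴ * E) *ᵥ (B *ᵥ ((σ * Bᴴ * E * B * σ) *ᵥ y)) := by
          simp only [mulVec_mulVec, Matrix.mul_assoc]
      _ = 0 := by rw [hB, mulVec_zero]
end

section
/- Let ρ and σ be nonzero positive semidefinite operators on a finite-dimensional complex inner product space H such that ρ is absolutely continuous with respect to σ (ρ ≪ σ). Suppose σ = R ρ R + τ with R, τ positive semidefinite and Tr(ρ τ) = 0, and set σ^{ac} := R ρ R. Then σ^{ac} and ρ are mutually absolutely continuous: σ^{ac} ≪ ρ and ρ ≪ σ^{ac}. -/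
open Matrix
open scoped Matrix ComplexOrder

open scoped MatrixOrder Matrix.Norms.L2Operator in
lemma Matrix.PosSemidef.mul_eq_zero_of_trace_mul_eq_zero {ι : Type*} [Fintype ι] [DecidableEq ι]
    {ρ τ : Matrix ι ι ℂ} (hρ : ρ.PosSemidef) (hτ : τ.PosSemidef)
    (h : (ρ * τ).trace = 0) : τ * ρ = 0 := by
  obtain ⟨B, rfl⟩ := CStarAlgebra.nonneg_iff_eq_star_mul_self.mp hρ.nonneg
  obtain ⟨C, rfl⟩ := CStarAlgebra.nonneg_iff_eq_star_mul_self.mp hτ.nonneg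
  simp only [Matrix.star_eq_conjTranspose] at h ⊢
  have hCB : C * Bᴴ = 0 := by
    rw [← Matrix.trace_conjTranspose_mul_self_eq_zero_iff, ← h, Matrix.conjTranspose_mul,
      Matrix.conjTranspose_conjTranspose, Matrix.mul_assoc Bᴴ B,
      Matrix.trace_mul_comm Bᴴ]
    simp only [Matrix.mul_assoc]
  rw [Matrix.mul_assoc, ← Matrix.mul_assoc C, hCB, Matrix.zero_mul, Matrix.mul_zero]

lemma Matrix.PosSemidef.re_dotProduct_mulVec_pos_iff {ι : Type*} [Fintype ι]
    {A : Matrix ι ι ℂ} (hA : A.PosSemidef) (x : ι → ℂ) :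
    0 < (star x ⬝ᵥ A.mulVec x).re ↔ A.mulVec x ≠ 0 := by
  obtain ⟨hre, him⟩ := Complex.nonneg_iff.mp (hA.dotProduct_mulVec_nonneg x)
  rw [hre.lt_iff_ne', not_iff_not, ← hA.dotProduct_mulVec_zero_iff x, Complex.ext_iff]
  simp [← him]

/-- Corollary 3.2: if `ρ ≪ σ`, then the absolutely continuous part `σ^{ac} = R ρ R`
of the quantum Lebesgue decomposition of `σ` w.r.t. `ρ` is mutually absolutely
continuous with `ρ`. -/
theorem stmt_6 {ι : Type*} [Fintype ι] [DecidableEq ι]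
    (ρ σ R τ : Matrix ι ι ℂ)
    (hρ : ρ.PosSemidef) (hσ : σ.PosSemidef) (hρ0 : ρ ≠ 0) (hσ0 : σ ≠ 0)
    (hac : AbsContWrt ρ σ)
    (hR : R.PosSemidef) (hτ : τ.PosSemidef)
    (hdec : σ = R * ρ * R + τ) (hsing : (ρ * τ).trace = 0) :
    AbsContWrt (R * ρ * R) ρ ∧ AbsContWrt ρ (R * ρ * R) := by
  have hτρ : τ * ρ = 0 := hρ.mul_eq_zero_of_trace_mul_eq_zero hτ hsing
  have hRρR : (R * ρ * R).PosSemidef := by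
    simpa only [hR.isHermitian.eq] using hρ.conjTranspose_mul_mul_same R
  have hac' : AbsContWrt ρ (R * ρ * R) := by
    rintro x ⟨y, rfl⟩ hx
    simpa [hdec, Matrix.add_mul, Matrix.mulVec_mulVec, hτρ] using hac _ ⟨y, rfl⟩ hx
  refine ⟨?_, hac'⟩
  rintro x ⟨y, rfl⟩ hx
  rw [hρ.re_dotProduct_mulVec_pos_iff]
  intro hzero
  have hy : ρ *ᵥ R *ᵥ y ≠ 0 := by
    intro h
    simp [← Matrix.mulVec_mulVec, h] at hx
  refine (hRρR.re_dotProduct_mulVec_pos_iff _).mp (hac' _ ⟨_, rfl⟩ hy) ?_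
  simp only [← Matrix.mulVec_mulVec] at hzero ⊢
  rw [hzero, Matrix.mulVec_zero]
end

section
/- Tensor powers of the quantum Lebesgue decomposition: Let ρ and σ be density operators on a finite-dimensional complex Hilbert space H, and let R be a positive semidefinite operator with R ρ R ≤ σ and Tr(ρ (σ − R ρ R)) = 0 (i.e., R is a version of the square-root likelihood ratio of σ relative to ρ). Then for every n ∈ ℕ, the n-fold tensor power R^{⊗n} satisfies R^{⊗n} ρ^{⊗n} R^{⊗n} = (R ρ R)^{⊗n} ≤ σ^{⊗n} and Tr( ρ^{⊗n} ( σ^{⊗n} − R^{⊗n} ρ^{⊗n} R^{⊗n} ) ) = 0; that is, R^{⊗n} is a version of the square-root likelihood ratio of σ^{⊗n} relative to ρ^{⊗n}, and the absolutely continuous part of σ^{⊗n} with respect to ρ^{⊗n} equals the n-fold tensor power of the absolutely continuous part of σ with respect to ρ. -/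
open Matrix
open scoped Matrix ComplexOrder

/-- `n`-fold tensor (Kronecker) power of a matrix, realized on the product basis
indexed by functions `Fin n → ι`. -/
def tpow {ι : Type*} [Fintype ι] [DecidableEq ι] (A : Matrix ι ι ℂ) (n : ℕ) :
    Matrix (Fin n → ι) (Fin n → ι) ℂ :=
  Matrix.of fun x y => ∏ t, A (x t) (y t)

/-- The Kronecker product of a finite family of square matrices, on the product basis. -/
def familyKronecker {κ ι : Type*} [Fintype κ] (F : κ → Matrix ι ι ℂ) :
    Matrix (κ → ι) (κ → ι) ℂ :=
  Matrix.of fun x y => ∏ t, F t (x t) (y t)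

lemma familyKronecker_mul {κ ι : Type*} [Fintype κ] [DecidableEq κ] [Fintype ι]
    (F G : κ → Matrix ι ι ℂ) :
    familyKronecker F * familyKronecker G = familyKronecker fun t => F t * G t := by
  ext x y
  simp only [familyKronecker, Matrix.mul_apply, Matrix.of_apply, Fintype.prod_sum,
    Finset.prod_mul_distrib]

lemma conjTranspose_familyKronecker {κ ι : Type*} [Fintype κ] (F : κ → Matrix ι ι ℂ) :
    (familyKronecker F)ᴴ = familyKronecker fun t => (F t)ᴴ := by
  ext x y
  simp [familyKronecker, Matrix.conjTranspose_apply]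

lemma trace_familyKronecker {κ ι : Type*} [Fintype κ] [DecidableEq κ] [Fintype ι]
    (F : κ → Matrix ι ι ℂ) :
    (familyKronecker F).trace = ∏ t, (F t).trace := by
  simp only [familyKronecker, Matrix.trace, Matrix.diag_apply, Matrix.of_apply, Fintype.prod_sum]

open scoped MatrixOrder in
lemma posSemidef_familyKronecker {κ ι : Type*} [Fintype κ] [DecidableEq κ] [Fintype ι]
    [DecidableEq ι] {F : κ → Matrix ι ι ℂ} (hF : ∀ t, (F t).PosSemidef) :
    (familyKronecker F).PosSemidef := by
  choose B hB using fun t => CStarAlgebra.nonneg_iff_eq_star_mul_self.mp (hF t).nonneg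
  obtain rfl : F = fun t => (B t)ᴴ * B t := funext hB
  rw [← familyKronecker_mul, ← conjTranspose_familyKronecker]
  exact Matrix.posSemidef_conjTranspose_mul_self _

lemma familyKronecker_add {κ ι : Type*} [Fintype κ] [DecidableEq κ] (F G : κ → Matrix ι ι ℂ) :
    familyKronecker (fun t => F t + G t) =
      ∑ s : Finset κ, familyKronecker fun t => if t ∈ s then F t else G t := by
  ext x y
  simp only [familyKronecker, Matrix.of_apply, Matrix.sum_apply, Matrix.add_apply,
    Fintype.prod_add]
  refine Finset.sum_congr rfl fun s _ => ?_
  rw [← Finset.prod_mul_prod_compl s]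
  congr 1
  · exact Finset.prod_congr rfl fun t ht => by simp [ht]
  · exact Finset.prod_congr rfl fun t ht => by simp [Finset.mem_compl.mp ht]

/-- The Kronecker product is monotone on positive semidefinite families. -/
lemma posSemidef_familyKronecker_sub {κ ι : Type*} [Fintype κ] [DecidableEq κ] [Fintype ι]
    [DecidableEq ι] {F G : κ → Matrix ι ι ℂ} (hF : ∀ t, (F t).PosSemidef)
    (hFG : ∀ t, (G t - F t).PosSemidef) :
    (familyKronecker G - familyKronecker F).PosSemidef := by
  have hG : familyKronecker G = familyKronecker fun t => F t + (G t - F t) := by simp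
  rw [hG, familyKronecker_add, ← Finset.add_sum_erase _ _ (Finset.mem_univ Finset.univ)]
  simp only [Finset.mem_univ, if_true, add_sub_cancel_left]
  refine Matrix.posSemidef_sum _ fun s _ => posSemidef_familyKronecker fun t => ?_
  split_ifs
  exacts [hF t, hFG t]

lemma tpow_eq_familyKronecker {ι : Type*} [Fintype ι] [DecidableEq ι] (A : Matrix ι ι ℂ) (n : ℕ) :
    tpow A n = familyKronecker fun _ : Fin n => A :=
  rfl

/-- Tensor powers of the quantum Lebesgue decomposition: if `R` is a square-root
likelihood ratio of `σ` relative to `ρ` (both density operators), then `R^{⊗n}` is a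
square-root likelihood ratio of `σ^{⊗n}` relative to `ρ^{⊗n}`, with absolutely
continuous part `(R ρ R)^{⊗n}`. -/
theorem stmt_18 {ι : Type*} [Fintype ι] [DecidableEq ι]
    (ρ σ R : Matrix ι ι ℂ)
    (hρ : ρ.PosSemidef) (hρ1 : ρ.trace = 1) (hσ : σ.PosSemidef) (hσ1 : σ.trace = 1)
    (hR : R.PosSemidef) (hle : (σ - R * ρ * R).PosSemidef)
    (hsing : (ρ * (σ - R * ρ * R)).trace = 0) (n : ℕ) :
    (tpow R n).PosSemidef ∧
    tpow R n * tpow ρ n * tpow R n = tpow (R * ρ * R) n ∧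
    (tpow σ n - tpow R n * tpow ρ n * tpow R n).PosSemidef ∧
    (tpow ρ n * (tpow σ n - tpow R n * tpow ρ n * tpow R n)).trace = 0 := by
  have hA : (R * ρ * R).PosSemidef := by
    simpa only [hR.isHermitian.eq] using hρ.conjTranspose_mul_mul_same R
  have hmul : tpow R n * tpow ρ n * tpow R n = tpow (R * ρ * R) n := by
    simp only [tpow_eq_familyKronecker, familyKronecker_mul]
  have htr : (ρ * σ).trace = (ρ * (R * ρ * R)).trace := by
    rwa [Matrix.mul_sub, Matrix.trace_sub, sub_eq_zero] at hsing
  refine ⟨posSemidef_familyKronecker fun _ => hR, hmul, ?_, ?_⟩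
  · rw [hmul]
    exact posSemidef_familyKronecker_sub (fun _ => hA) fun _ => hle
  · rw [hmul, Matrix.mul_sub, Matrix.trace_sub]
    simp only [tpow_eq_familyKronecker, familyKronecker_mul, trace_familyKronecker, htr, sub_self]
end
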